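/- arXiv:1407.8022 — 3 statements merged into one kernel-verified Lean document; each statement's English description precedes it below -/
import Mathlib

section
/- Let d > 0 and let V be a real random variable uniformly distributed on [−d/2, d/2). Then for every fixed real number x, the second moment of the dithered modulo signal satisfies E[(M_d(x + V))²] = d²/12. In particular, if d = √(12·P̃) for some P̃ > 0, then E[(M_d(x + V))²] = P̃. -/
open MeasureTheory

/-- The centered modulo operation: `Md d x = x - d * round (x / d)`,
where `round` rounds to the nearest integer with ties rounded up. -/
noncomputable def Md (d x : ℝ) : ℝ := x - d * round (x / d)

/-- The uniform probability measure on `[-d/2, d/2)`: Lebesgue measure restricted to the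
interval, divided by `d`. -/
noncomputable def unifIco (d : ℝ) : Measure ℝ :=
  (ENNReal.ofReal d)⁻¹ • volume.restrict (Set.Ico (-(d / 2)) (d / 2))

theorem Md_periodic {d : ℝ} (hd : d ≠ 0) : Function.Periodic (Md d) d := by
  intro x
  simp only [Md, add_div, div_self hd, round_add_one]
  push_cast
  ring

theorem measurable_Md (d : ℝ) : Measurable (Md d) := by
  unfold Md
  simp only [round_eq]
  fun_prop

theorem Md_eq_self {d x : ℝ} (hd : 0 < d) (hx : x ∈ Set.Ico (-(d / 2)) (d / 2)) :
    Md d x = x := by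
  have hround : round (x / d) = 0 := by
    rw [round_eq_zero_iff, Set.mem_Ico, le_div_iff₀ hd, div_lt_iff₀ hd]
    constructor <;> linarith [hx.1, hx.2]
  simp [Md, hround]

theorem setIntegral_Ico_Md_sq {d : ℝ} (hd : 0 < d) :
    ∫ v in Set.Ico (-(d / 2)) (d / 2), Md d v ^ 2 = d ^ 3 / 12 := by
  rw [setIntegral_congr_fun (g := fun v => v ^ 2) measurableSet_Ico
      fun v hv => by simp only [Md_eq_self hd hv],
    integral_Ico_eq_integral_Ioc, ← intervalIntegral.integral_of_le (by linarith), integral_pow]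
  push_cast
  ring

/-- By periodicity, the integral of `Md d ^ 2` over a period does not depend on a shift. -/
theorem setIntegral_Ico_Md_add_sq {d : ℝ} (hd : 0 < d) (x : ℝ) :
    ∫ v in Set.Ico (-(d / 2)) (d / 2), Md d (x + v) ^ 2 = d ^ 3 / 12 := by
  have hle : -(d / 2) ≤ d / 2 := by linarith
  have hper : Function.Periodic (fun v => Md d v ^ 2) d := fun v => by
    simp only [Md_periodic hd.ne' v]
  rw [← setIntegral_Ico_Md_sq hd, integral_Ico_eq_integral_Ioc, integral_Ico_eq_integral_Ioc,
    ← intervalIntegral.integral_of_le hle, ← intervalIntegral.integral_of_le hle,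
    intervalIntegral.integral_comp_add_left (fun v => Md d v ^ 2)]
  convert hper.intervalIntegral_add_eq (x + -(d / 2)) (-(d / 2)) using 2 <;> ring

theorem integral_unifIco_Md_add_sq {d : ℝ} (hd : 0 < d) (x : ℝ) :
    ∫ v, Md d (x + v) ^ 2 ∂unifIco d = d ^ 2 / 12 := by
  rw [unifIco, integral_smul_measure, setIntegral_Ico_Md_add_sq hd, ENNReal.toReal_inv,
    ENNReal.toReal_ofReal hd.le, smul_eq_mul]
  field_simp

/-- If `V` is uniform on `[-d/2, d/2)`, then for any fixed `x`,
`E[(Md d (x + V))²] = d²/12`; in particular if `d = √(12·P̃)` with `P̃ > 0`, this equals `P̃`. -/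
theorem dithered_modulo_second_moment {Ω : Type*} [MeasurableSpace Ω]
    (μ : Measure Ω) [IsProbabilityMeasure μ]
    (d : ℝ) (hd : 0 < d) (V : Ω → ℝ) (hV : Measurable V)
    (hlaw : μ.map V = unifIco d) (x : ℝ) :
    (∫ ω, (Md d (x + V ω)) ^ 2 ∂μ) = d ^ 2 / 12 ∧
      ∀ Pt : ℝ, 0 < Pt → d = Real.sqrt (12 * Pt) →
        (∫ ω, (Md d (x + V ω)) ^ 2 ∂μ) = Pt := by
  have hmoment : ∫ ω, (Md d (x + V ω)) ^ 2 ∂μ = d ^ 2 / 12 := by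
    have hmeas : Measurable fun v => Md d (x + v) ^ 2 :=
      ((measurable_Md d).comp (measurable_const_add x)).pow_const 2
    rw [← integral_unifIco_Md_add_sq hd x, ← hlaw,
      integral_map hV.aemeasurable hmeas.aestronglyMeasurable]
  refine ⟨hmoment, fun Pt hPt hdPt => ?_⟩
  rw [hmoment, hdPt, Real.sq_sqrt (by positivity)]
  ring
end

section
/- For every snr > 0, every integer N ≥ 1, and every R > 0, letting C = (1/2)·log₂(1 + snr), the following strict inequality holds: 2·Q(√(3·snr·(1 + snr)^{N−1}/(2^{2NR} − 1))) < exp(−(3/2)·(snr/(1 + snr))·2^{2N(C − R)}). (This is the doubly exponential decay of the error probability of the Schalkwijk–Kailath scheme in the number of rounds N for rates R below capacity C.) -/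
open MeasureTheory

/-- The Gaussian Q-function `Q(x) = (2π)^{-1/2} ∫_x^∞ exp(-u²/2) du`. -/
noncomputable def gaussQ (x : ℝ) : ℝ :=
  (2 * Real.pi) ^ (-(1 : ℝ) / 2) * ∫ u in Set.Ioi x, Real.exp (-u ^ 2 / 2)

/-- The Chernoff-type bound `Q(x) ≤ exp(-x²/2) / 2` for `x ≥ 0`. -/
lemma gaussQ_le_half_exp {x : ℝ} (hx : 0 ≤ x) :
    gaussQ x ≤ 1 / 2 * Real.exp (-x ^ 2 / 2) := by
  have integrable_gauss : Integrable fun u : ℝ => Real.exp (-u ^ 2 / 2) := by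
    convert integrable_exp_neg_mul_sq (b := 1 / 2) (by norm_num) using 3
    ring
  have shift : ∫ u in Set.Ioi x, Real.exp (-u ^ 2 / 2)
      = ∫ u in Set.Ioi (0 : ℝ), Real.exp (-(u + x) ^ 2 / 2) := by
    rw [← (measurePreserving_add_right volume x).setIntegral_preimage_emb
      (measurableEmbedding_addRight x)]
    simp
  have half_line : ∫ u in Set.Ioi (0 : ℝ), Real.exp (-u ^ 2 / 2)
      = Real.sqrt (2 * Real.pi) / 2 := by
    convert integral_gaussian_Ioi (1 / 2) using 4
    all_goals ring_nf
  have tail_le : ∫ u in Set.Ioi (0 : ℝ), Real.exp (-(u + x) ^ 2 / 2)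
      ≤ Real.exp (-x ^ 2 / 2) * (Real.sqrt (2 * Real.pi) / 2) := by
    rw [← half_line, ← integral_const_mul]
    refine setIntegral_mono_on (integrable_gauss.comp_add_right x).integrableOn
      (integrable_gauss.const_mul _).integrableOn measurableSet_Ioi fun u hu => ?_
    rw [← Real.exp_add]
    refine Real.exp_le_exp.2 ?_
    nlinarith [mul_nonneg (le_of_lt (Set.mem_Ioi.1 hu)) hx]
  have two_pi_pos : (0 : ℝ) < 2 * Real.pi := by positivity
  have normalize : (2 * Real.pi) ^ (-(1 : ℝ) / 2) * Real.sqrt (2 * Real.pi) = 1 := by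
    rw [Real.sqrt_eq_rpow, ← Real.rpow_add two_pi_pos]
    norm_num
  calc gaussQ x ≤ (2 * Real.pi) ^ (-(1 : ℝ) / 2)
        * (Real.exp (-x ^ 2 / 2) * (Real.sqrt (2 * Real.pi) / 2)) := by
        rw [gaussQ, shift]
        gcongr
    _ = (2 * Real.pi) ^ (-(1 : ℝ) / 2) * Real.sqrt (2 * Real.pi)
        * (1 / 2 * Real.exp (-x ^ 2 / 2)) := by ring
    _ = 1 / 2 * Real.exp (-x ^ 2 / 2) := by rw [normalize, one_mul]

/-- `2^{2N(C-R)} = (1+snr)^N / 2^{2NR}` for `C = (1/2)log₂(1+snr)`. -/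
lemma two_rpow_capacity_sub {snr : ℝ} (hsnr : 0 < 1 + snr) (N : ℕ) (R : ℝ) :
    (2 : ℝ) ^ (2 * (N : ℝ) * ((1 / 2) * Real.logb 2 (1 + snr) - R))
      = (1 + snr) ^ N / (2 : ℝ) ^ (2 * (N : ℝ) * R) := by
  rw [show 2 * (N : ℝ) * ((1 / 2) * Real.logb 2 (1 + snr) - R)
      = Real.logb 2 (1 + snr) * N - 2 * (N : ℝ) * R by ring,
    Real.rpow_sub two_pos, Real.rpow_mul zero_le_two,
    Real.rpow_logb two_pos (by norm_num) hsnr, Real.rpow_natCast]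

/-- Doubly exponential decay of the Schalkwijk–Kailath error probability: with
`snr_N = snr(1+snr)^{N−1}` and `C = (1/2)log₂(1+snr)`,
`2Q(√(3·snr_N/(2^{2NR}−1))) < exp(−(3/2)·(snr/(1+snr))·2^{2N(C−R)})`. -/
theorem sk_doubly_exponential_decay (snr : ℝ) (hsnr : 0 < snr)
    (N : ℕ) (hN : 1 ≤ N) (R : ℝ) (hR : 0 < R) :
    2 * gaussQ (Real.sqrt (3 * (snr * (1 + snr) ^ (N - 1)) /
        ((2 : ℝ) ^ (2 * (N : ℝ) * R) - 1))) <
      Real.exp (-(3 / 2) * (snr / (1 + snr)) *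
        (2 : ℝ) ^ (2 * (N : ℝ) * ((1 / 2) * Real.logb 2 (1 + snr) - R))) := by
  rw [two_rpow_capacity_sub (by linarith)]
  have one_lt : (1 : ℝ) < 2 ^ (2 * (N : ℝ) * R) :=
    Real.one_lt_rpow one_lt_two (by positivity)
  set A : ℝ := 2 ^ (2 * (N : ℝ) * R)
  have sub_pos : 0 < A - 1 := by linarith
  set S : ℝ := 3 * (snr * (1 + snr) ^ (N - 1)) with hS
  have S_pos : 0 < S := by positivity
  have exponent_eq : -(3 / 2) * (snr / (1 + snr)) * ((1 + snr) ^ N / A) = -(S / A) / 2 := by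
    obtain ⟨n, rfl⟩ := Nat.exists_eq_add_of_le' hN
    rw [hS, Nat.add_sub_cancel, pow_succ]
    field_simp
  have S_div_lt : S / A < S / (A - 1) :=
    div_lt_div_of_pos_left S_pos sub_pos (by linarith)
  have Q_le := gaussQ_le_half_exp (Real.sqrt_nonneg (S / (A - 1)))
  rw [Real.sq_sqrt (by positivity)] at Q_le
  calc 2 * gaussQ (Real.sqrt (S / (A - 1))) ≤ Real.exp (-(S / (A - 1)) / 2) := by linarith
    _ < Real.exp (-(3 / 2) * (snr / (1 + snr)) * ((1 + snr) ^ N / A)) := by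
      rw [exponent_eq]
      exact Real.exp_lt_exp.2 (by linarith)
end

section
/- Let N ≥ 1 be an integer and let snr > 0, Γ₀ > 0, Ψ₁ > 0, Ψ₂ > 0 be real numbers such that κ := snr · Ψ₁^{−(N−1)/N} · Ψ₂^{−(N−1)/N} · Γ₀^{−1/N} > 1. Define snr_N = snr · (1 + snr/(Ψ₁·Ψ₂))^{N−1}, the rate R = (1/(2N))·log₂(1 + snr_N/Γ₀), and the capacity gap Γ = snr/(2^{2R} − 1). Then Γ ≤ Γ₀^{1/N} · (Ψ₁·Ψ₂)^{(N−1)/N} · exp(1/(κ − 1)). Equivalently, in decibels, Γ_dB ≤ (1/N)·Γ₀,dB + ((N−1)/N)·(Ψ₁,dB + Ψ₂,dB) + Ψ₃, where Ψ₃ = (10/ln 10)/(κ − 1) and x_dB = 10·log₁₀(x). (This is the algebraic core of the paper's main theorem bounding the capacity gap of the N-round noisy-feedback interactive scheme.) -/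
/-- The `N`-th power of the geometric mean of one factor `a` and `N - 1` factors `b`. -/
lemma rpow_one_div_mul_rpow_pow {N : ℕ} (hN : 1 ≤ N) {a b : ℝ} (ha : 0 ≤ a) (hb : 0 ≤ b) :
    (a ^ ((1 : ℝ) / N) * b ^ (((N : ℝ) - 1) / N)) ^ N = a * b ^ (N - 1) := by
  have hN0 : (N : ℝ) ≠ 0 := by positivity
  rw [mul_pow, ← Real.rpow_mul_natCast ha, ← Real.rpow_mul_natCast hb, div_mul_cancel₀ _ hN0,
    div_mul_cancel₀ _ hN0, Real.rpow_one, ← Nat.cast_pred hN, Real.rpow_natCast]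

lemma div_sub_one_le_exp {κ : ℝ} (hκ : 1 < κ) : κ / (κ - 1) ≤ Real.exp (1 / (κ - 1)) := by
  have h : κ - 1 ≠ 0 := (sub_pos.2 hκ).ne'
  calc κ / (κ - 1) = 1 / (κ - 1) + 1 := by field_simp; ring
    _ ≤ Real.exp (1 / (κ - 1)) := Real.add_one_le_exp _

/-- Algebraic core of the main theorem: for the `N`-round noisy-feedback scheme with
effective SNR `snr_N = snr(1 + snr/(Ψ₁Ψ₂))^{N−1}`, rate `R = (1/(2N))log₂(1+snr_N/Γ₀)`
and capacity gap `Γ = snr/(2^{2R}−1)`, if `κ = snr·Ψ₁^{-(N-1)/N}·Ψ₂^{-(N-1)/N}·Γ₀^{-1/N} > 1`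
then `Γ ≤ Γ₀^{1/N}(Ψ₁Ψ₂)^{(N−1)/N}·exp(1/(κ−1))`; equivalently, in decibels,
`Γ_dB ≤ (1/N)Γ₀,dB + ((N−1)/N)(Ψ₁,dB + Ψ₂,dB) + Ψ₃` with `Ψ₃ = (10/ln 10)/(κ−1)`. -/
theorem capacity_gap_bound (N : ℕ) (hN : 1 ≤ N)
    (snr Γ0 Ψ1 Ψ2 : ℝ) (hsnr : 0 < snr) (hΓ0 : 0 < Γ0) (hΨ1 : 0 < Ψ1) (hΨ2 : 0 < Ψ2)
    (κ : ℝ)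
    (hκdef : κ = snr * Ψ1 ^ (-(((N : ℝ) - 1) / N)) * Ψ2 ^ (-(((N : ℝ) - 1) / N)) *
      Γ0 ^ (-(1 / (N : ℝ))))
    (hκ : 1 < κ)
    (snrN R Γ : ℝ)
    (hsnrN : snrN = snr * (1 + snr / (Ψ1 * Ψ2)) ^ (N - 1))
    (hR : R = 1 / (2 * (N : ℝ)) * Real.logb 2 (1 + snrN / Γ0))
    (hΓ : Γ = snr / ((2 : ℝ) ^ (2 * R) - 1)) :
    Γ ≤ Γ0 ^ ((1 : ℝ) / N) * (Ψ1 * Ψ2) ^ (((N : ℝ) - 1) / N) * Real.exp (1 / (κ - 1)) ∧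
    10 * Real.logb 10 Γ ≤ (1 / (N : ℝ)) * (10 * Real.logb 10 Γ0) +
      (((N : ℝ) - 1) / N) * (10 * Real.logb 10 Ψ1 + 10 * Real.logb 10 Ψ2) +
      (10 / Real.log 10) / (κ - 1) := by
  have hN0 : (N : ℝ) ≠ 0 := by positivity
  have hΨ : 0 < Ψ1 * Ψ2 := mul_pos hΨ1 hΨ2
  have hκ1 : 0 < κ - 1 := sub_pos.2 hκ
  set C := Γ0 ^ ((1 : ℝ) / N) * (Ψ1 * Ψ2) ^ (((N : ℝ) - 1) / N) with hC
  have hC0 : 0 < C := by positivity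
  have hCN : C ^ N = Γ0 * (Ψ1 * Ψ2) ^ (N - 1) := rpow_one_div_mul_rpow_pow hN hΓ0.le hΨ.le
  have hκC : κ = snr / C := by
    rw [hκdef, hC, Real.mul_rpow hΨ1.le hΨ2.le, Real.rpow_neg hΨ1.le, Real.rpow_neg hΨ2.le,
      Real.rpow_neg hΓ0.le]
    field_simp
  have hsnrN0 : 0 < snrN := by rw [hsnrN]; positivity
  have hA : (2 : ℝ) ^ (2 * R) = (1 + snrN / Γ0) ^ ((N : ℝ)⁻¹) := by
    have h : 2 * R = Real.logb 2 (1 + snrN / Γ0) * (N : ℝ)⁻¹ := by rw [hR]; field_simp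
    rw [h, Real.rpow_mul two_pos.le, Real.rpow_logb two_pos (by norm_num) (by positivity)]
  have hκN : κ ^ N ≤ 1 + snrN / Γ0 := by
    calc κ ^ N = snr * (snr / (Ψ1 * Ψ2)) ^ (N - 1) / Γ0 := by
          rw [hκC, div_pow, hCN, div_pow, ← mul_pow_sub_one (Nat.one_le_iff_ne_zero.1 hN) snr]
          field_simp
      _ ≤ snrN / Γ0 := by
          rw [hsnrN]
          gcongr
          linarith
      _ ≤ 1 + snrN / Γ0 := by linarith
  have hκA : κ ≤ (2 : ℝ) ^ (2 * R) := by
    rw [hA, Real.le_rpow_inv_iff_of_pos (by linarith) (by positivity) (by positivity),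
      Real.rpow_natCast]
    exact hκN
  have hΓ_pos : 0 < Γ := by rw [hΓ]; exact div_pos hsnr (by linarith)
  have hbound : Γ ≤ C * Real.exp (1 / (κ - 1)) := by
    calc Γ ≤ snr / (κ - 1) := by rw [hΓ]; gcongr
      _ = C * (κ / (κ - 1)) := by
          have h : snr = C * κ := by rw [hκC]; field_simp
          rw [h, mul_div_assoc]
      _ ≤ C * Real.exp (1 / (κ - 1)) := by gcongr; exact div_sub_one_le_exp hκ
  refine ⟨hbound, ?_⟩
  have hlog : Real.log Γ ≤ 1 / N * Real.log Γ0 +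
      ((N : ℝ) - 1) / N * (Real.log Ψ1 + Real.log Ψ2) + 1 / (κ - 1) := by
    refine (Real.log_le_log hΓ_pos hbound).trans_eq ?_
    rw [Real.log_mul hC0.ne' (Real.exp_ne_zero _), Real.log_exp, hC,
      Real.log_mul (by positivity) (by positivity), Real.log_rpow hΓ0, Real.log_rpow hΨ,
      Real.log_mul hΨ1.ne' hΨ2.ne']
  have hlog10 : 0 < Real.log 10 := Real.log_pos (by norm_num)
  calc 10 * Real.logb 10 Γ = 10 / Real.log 10 * Real.log Γ := by rw [Real.logb]; ring
    _ ≤ 10 / Real.log 10 * (1 / N * Real.log Γ0 +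
        ((N : ℝ) - 1) / N * (Real.log Ψ1 + Real.log Ψ2) + 1 / (κ - 1)) := by gcongr
    _ = _ := by simp only [Real.logb]; ring
end
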